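/- Let D_8 ⊆ GL_2(ℂ) be the dihedral group of order 8 generated by diag(i, −i) and ((0,1),(1,0)), acting diagonally on V³ = (ℂ²)³. Then ℂ[V³]^{D_8} is a free module over P(4,3) := ℂ[p_{4,0,0}, p_{0,4,0}, p_{0,0,4}, q_{2,0,0}, q_{0,2,0}, q_{0,0,2}], with basis the family obtained as follows: for each element f in the list below (which has weakly decreasing multidegree α), take s·f for s ranging over a set of left coset representatives in S_3 of the stabilizer of α, where S_3 permutes the three variable pairs (x_i, y_i). The list: 1; q_{1,1,0}; p_{2,1,1}, q_{1,1,0}q_{1,0,1}; p_{2,2,0}, q_{1,1,0}²; p_{3,1,0}; p_{3,1,0}q_{0,1,1}, q_{1,1,0}²q_{1,0,1}; q_{1,1,0}³; p_{3,1,0}q_{1,0,1}; p_{2,1,1}p_{1,2,1}, p_{3,1,0}q_{0,1,1}²; p_{3,1,0}q_{1,0,1}q_{0,1,1}, q_{1,1,0}²q_{1,0,1}²; q_{1,1,0}³q_{1,0,1}; q_{1,1,0}⁴; p_{3,1,0}q_{1,0,1}q_{0,1,1}². -/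

import Mathlib

open MvPolynomial

noncomputable section

/-- `ℂ[V^m]` for `V = ℂ²`: variable `(0, i)` is `xᵢ`, variable `(1, i)` is `yᵢ`. -/
abbrev PolyVm (m : ℕ) : Type := MvPolynomial (Fin 2 × Fin m) ℂ

/-- A `Finsupp` on `Fin m` built from a tuple. -/
def fsOf {m : ℕ} (v : Fin m → ℕ) : Fin m →₀ ℕ := Finsupp.equivFunOnFinite.symm v

@[simp] lemma fsOf_apply {m : ℕ} (v : Fin m → ℕ) (i : Fin m) : fsOf v i = v i := rfl

lemma fsOf_sum2 (a b : ℕ) : ∑ i, fsOf ![a, b] i = a + b := by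
  simp [Fin.sum_univ_two]

lemma fsOf_sum3 (a b c : ℕ) : ∑ i, fsOf ![a, b, c] i = a + b + c := by
  simp [Fin.sum_univ_three]

/-- The polarization `p_β = x^β + y^β` of `p = xⁿ + yⁿ`. -/
def pPoly {m : ℕ} (β : Fin m →₀ ℕ) : PolyVm m :=
  (∏ i, X (0, i) ^ β i) + (∏ i, X (1, i) ^ β i)

/-- The polarization `q_α` of `q = xy` : `q_{2eᵢ} = xᵢyᵢ` and
`q_{eᵢ+eⱼ} = (xᵢyⱼ + xⱼyᵢ)/2` for `i ≠ j`. -/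
def qPoly {m : ℕ} (α : Fin m →₀ ℕ) : PolyVm m :=
  ((((Finset.univ.filter fun ij : Fin m × Fin m =>
      Finsupp.single ij.1 1 + Finsupp.single ij.2 1 = α).card : ℕ) : ℂ))⁻¹ •
  ∑ ij ∈ Finset.univ.filter (fun ij : Fin m × Fin m =>
      Finsupp.single ij.1 1 + Finsupp.single ij.2 1 = α),
    X (0, ij.1) * X (1, ij.2)

/-- Variables of the free symmetric algebra `F(n,m)`: `ρ_α` for `|α| = 2`
(left summand) and `π_β` for `|β| = n` (right summand). -/
abbrev FVar (n m : ℕ) : Type :=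
  {d : Fin m →₀ ℕ // ∑ i, d i = 2} ⊕ {d : Fin m →₀ ℕ // ∑ i, d i = n}

/-- The polynomial algebra `F(n,m) = ℂ[ρ_α, π_β]`. -/
abbrev FAlg (n m : ℕ) : Type := MvPolynomial (FVar n m) ℂ

/-- The canonical surjection `φ(n,m) : F(n,m) → ℂ[V^m]^{D_{2n}} ⊆ ℂ[V^m]`,
`ρ_α ↦ q_α`, `π_β ↦ p_β`. -/
def phi (n m : ℕ) : FAlg n m →ₐ[ℂ] PolyVm m :=
  aeval (Sum.elim (fun a => qPoly a.1) (fun b => pPoly b.1))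

/-- The weights of the grading of `F(n,m)`: `deg ρ_α = 2`, `deg π_β = n`. -/
def wF (n m : ℕ) : FVar n m → ℕ := Sum.elim (fun _ => 2) (fun _ => n)

/-- The matrix `diag(ω, ω⁻¹)`. -/
def dMat (ω : ℂ) : Matrix (Fin 2) (Fin 2) ℂ := !![ω, 0; 0, ω⁻¹]

/-- The matrix `((0,1),(1,0))`. -/
def sMat : Matrix (Fin 2) (Fin 2) ℂ := !![0, 1; 1, 0]

/-- The action of a `2×2` matrix `g` on `ℂ[V^m]` (diagonal action on the `m`
vector variables): `x_{a,i} ↦ ∑_b g_{a b} x_{b,i}`. -/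
def actG {m : ℕ} (g : Matrix (Fin 2) (Fin 2) ℂ) : PolyVm m →ₐ[ℂ] PolyVm m :=
  aeval fun p => ∑ b : Fin 2, g p.1 b • X (b, p.2)

/-- The subalgebra of `ℂ[V^m]` of polynomials invariant under (the group
generated by) a set `S` of `2×2` matrices. -/
def invAlg (m : ℕ) (S : Set (Matrix (Fin 2) (Fin 2) ℂ)) : Subalgebra ℂ (PolyVm m) where
  carrier := {f | ∀ g ∈ Submonoid.closure S, actG g f = f}
  mul_mem' := fun ha hb => by
    intro g hg
    rw [map_mul, ha g hg, hb g hg]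
  add_mem' := fun ha hb => by
    intro g hg
    rw [map_add, ha g hg, hb g hg]
  algebraMap_mem' := fun c => by
    intro g hg
    exact (actG g).commutes c

/-- The invariant algebra `ℂ[V^m]^{D_{2n}}`, where `D_{2n}` is generated by
`diag(ω, ω⁻¹)` and `((0,1),(1,0))`. -/
def dihedralInv (m : ℕ) (ω : ℂ) : Subalgebra ℂ (PolyVm m) :=
  invAlg m {dMat ω, sMat}


/-- `xᵢ` in `ℂ[V³]` (0-indexed). -/
def xv (i : Fin 3) : PolyVm 3 := X (0, i)

/-- `yᵢ` in `ℂ[V³]` (0-indexed). -/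
def yv (i : Fin 3) : PolyVm 3 := X (1, i)

/-- The action of `s ∈ S₃` on `ℂ[V³]` permuting the three variable pairs `(xᵢ, yᵢ)`. -/
def permAct3 (s : Equiv.Perm (Fin 3)) : PolyVm 3 →ₐ[ℂ] PolyVm 3 :=
  rename fun p => (p.1, s p.2)

/-- The stabilizer of a multidegree `α` in `S₃`. -/
def mStab3 (α : Fin 3 → ℕ) : Set (Equiv.Perm (Fin 3)) := {s | ∀ j, α (s j) = α j}

/-- `C` is a set of left coset representatives of the stabilizer of `α` in `S₃`. -/
def IsCosetReps3 (α : Fin 3 → ℕ) (C : Set (Equiv.Perm (Fin 3))) : Prop :=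
  ∀ t : Equiv.Perm (Fin 3), ∃! s, s ∈ C ∧ s⁻¹ * t ∈ mStab3 α

/-- `P(4,3) = ℂ[p_{4,0,0}, p_{0,4,0}, p_{0,0,4}, q_{2,0,0}, q_{0,2,0}, q_{0,0,2}]`. -/
def P43 : Subalgebra ℂ (PolyVm 3) :=
  Algebra.adjoin ℂ
    {xv 0 ^ 4 + yv 0 ^ 4, xv 1 ^ 4 + yv 1 ^ 4, xv 2 ^ 4 + yv 2 ^ 4,
     xv 0 * yv 0, xv 1 * yv 1, xv 2 * yv 2}

def q110 : PolyVm 3 := C (1/2 : ℂ) * (xv 0 * yv 1 + xv 1 * yv 0)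
def q101 : PolyVm 3 := C (1/2 : ℂ) * (xv 0 * yv 2 + xv 2 * yv 0)
def q011 : PolyVm 3 := C (1/2 : ℂ) * (xv 1 * yv 2 + xv 2 * yv 1)
def p211 : PolyVm 3 := xv 0^2 * xv 1 * xv 2 + yv 0^2 * yv 1 * yv 2
def p121 : PolyVm 3 := xv 0 * xv 1^2 * xv 2 + yv 0 * yv 1^2 * yv 2
def p220 : PolyVm 3 := xv 0^2 * xv 1^2 + yv 0^2 * yv 1^2
def p310 : PolyVm 3 := xv 0^3 * xv 1 + yv 0^3 * yv 1

/-- The secondary S-generating system of `ℂ[V³]^{D₈}` (with decreasing multidegrees). -/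
def dihListD8 : List (PolyVm 3 × (Fin 3 → ℕ)) :=
  [ (1, ![0,0,0]),
    (q110, ![1,1,0]),
    (p211, ![2,1,1]), (q110 * q101, ![2,1,1]),
    (p220, ![2,2,0]), (q110^2, ![2,2,0]),
    (p310, ![3,1,0]),
    (p310 * q011, ![3,2,1]), (q110^2 * q101, ![3,2,1]),
    (q110^3, ![3,3,0]),
    (p310 * q101, ![4,1,1]),
    (p211 * p121, ![3,3,2]), (p310 * q011^2, ![3,3,2]),
    (p310 * q101 * q011, ![4,2,2]), (q110^2 * q101^2, ![4,2,2]),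
    (q110^3 * q101, ![4,3,1]),
    (q110^4, ![4,4,0]),
    (p310 * q101 * q011^2, ![4,3,3]) ]

/-! ### Coordinates, the action of `S₃` and `P(4,3)` -/

/-- The polarized form `xᵢyⱼ + xⱼyᵢ`. -/
def uPoly (i j : Fin 3) : PolyVm 3 := xv i * yv j + xv j * yv i

/-- The listed invariants, with denominators cleared, as functions of the three indices. -/
def invForm (n : Fin 18) (i j k : Fin 3) : PolyVm 3 :=
  let p310 := xv i ^ 3 * xv j + yv i ^ 3 * yv j
  let p220 := xv i ^ 2 * xv j ^ 2 + yv i ^ 2 * yv j ^ 2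
  let p211 := xv i ^ 2 * xv j * xv k + yv i ^ 2 * yv j * yv k
  let p121 := xv i * xv j ^ 2 * xv k + yv i * yv j ^ 2 * yv k
  ![1, uPoly i j, p211, uPoly i j * uPoly i k, p220, uPoly i j ^ 2, p310,
    p310 * uPoly j k, uPoly i j ^ 2 * uPoly i k, uPoly i j ^ 3, p310 * uPoly i k,
    p211 * p121, p310 * uPoly j k ^ 2, p310 * uPoly i k * uPoly j k,
    uPoly i j ^ 2 * uPoly i k ^ 2, uPoly i j ^ 3 * uPoly i k, uPoly i j ^ 4,
    p310 * uPoly i k * uPoly j k ^ 2] n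

@[simp] lemma permAct3_xv (t : Equiv.Perm (Fin 3)) (i : Fin 3) : permAct3 t (xv i) = xv (t i) := by
  simp [permAct3, xv]

@[simp] lemma permAct3_yv (t : Equiv.Perm (Fin 3)) (i : Fin 3) : permAct3 t (yv i) = yv (t i) := by
  simp [permAct3, yv]

lemma permAct3_invForm (t : Equiv.Perm (Fin 3)) (n : Fin 18) (i j k : Fin 3) :
    permAct3 t (invForm n i j k) = invForm n (t i) (t j) (t k) := by
  fin_cases n <;> simp [invForm, uPoly]

/-- The degree of the `n`-th listed invariant in the polarizations of `q`. -/
def qDegree : Fin 18 → ℕ := ![0, 1, 0, 2, 0, 2, 0, 1, 3, 3, 1, 0, 2, 2, 4, 4, 4, 3]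

lemma dihListD8_get_eq (n : Fin 18) :
    (dihListD8.get n).1 = C (1 / 2 : ℂ) ^ qDegree n * invForm n 0 1 2 := by
  fin_cases n <;>
    simp [dihListD8, qDegree, invForm, uPoly, q110, q101, q011, p211, p121, p220, p310,
      -C_1] <;>
    ring

lemma P43_le_of_generators {A : Subalgebra ℂ (PolyVm 3)}
    (hp : ∀ i, xv i ^ 4 + yv i ^ 4 ∈ A) (hq : ∀ i, xv i * yv i ∈ A) : P43 ≤ A := by
  refine Algebra.adjoin_le ?_
  rintro f (rfl | rfl | rfl | rfl | rfl | rfl)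
  exacts [hp 0, hp 1, hp 2, hq 0, hq 1, hq 2]

lemma pow_add_pow_mem_P43 (i : Fin 3) : xv i ^ 4 + yv i ^ 4 ∈ P43 := by
  fin_cases i <;> exact Algebra.subset_adjoin (by simp)

lemma xv_mul_yv_mem_P43 (i : Fin 3) : xv i * yv i ∈ P43 := by
  fin_cases i <;> exact Algebra.subset_adjoin (by simp)

lemma C_mem_P43 (c : ℂ) : C c ∈ P43 := P43.algebraMap_mem c

lemma P43_smul_mem (S : Submodule P43 (PolyVm 3)) {c h : PolyVm 3} (hc : c ∈ P43) (hh : h ∈ S) :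
    c * h ∈ S :=
  S.smul_mem (⟨c, hc⟩ : P43) hh

/-- An algebra endomorphism fixing `P(4,3)`, as a `P(4,3)`-linear map. -/
def linearOfFix (φ : PolyVm 3 →ₐ[ℂ] PolyVm 3) (hφ : ∀ c ∈ P43, φ c = c) :
    PolyVm 3 →ₗ[P43] PolyVm 3 where
  toFun := φ
  map_add' := map_add φ
  map_smul' c f := by
    rw [Subalgebra.smul_def, smul_eq_mul, map_mul, hφ _ c.2]; rfl

@[simp] lemma coe_ofNat_P43 (n : ℕ) [n.AtLeastTwo] :
    ((ofNat(n) : P43) : PolyVm 3) = ofNat(n) := rfl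

/-- `xᵢ⁴ + yᵢ⁴` as an element of `P(4,3)`. -/
def pGen (i : Fin 3) : P43 := ⟨_, pow_add_pow_mem_P43 i⟩

/-- `xᵢ yᵢ` as an element of `P(4,3)`. -/
def qGen (i : Fin 3) : P43 := ⟨_, xv_mul_yv_mem_P43 i⟩

/-! ### Spanning: from orbit representatives to all symmetrized products -/

/-- The submodule `S` contains all `S₃`-translates of the `n`-th listed invariant. -/
abbrev HasForm (S : Submodule P43 (PolyVm 3)) (n : Fin 18) : Prop :=
  ∀ i j k, i ≠ j → i ≠ k → j ≠ k → invForm n i j k ∈ S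

lemma mem_of_eq {S : Submodule P43 (PolyVm 3)} {f : PolyVm 3} (g : PolyVm 3) (h : f = g)
    (hg : g ∈ S) : f ∈ S := h ▸ hg

/-- A basis of `ℂ[xⱼ, yⱼ]` over `ℂ[xⱼ⁴ + yⱼ⁴, xⱼyⱼ]`. -/
def basisVec (j : Fin 3) : Fin 8 → PolyVm 3 :=
  ![1, xv j ^ 4 - yv j ^ 4, xv j, yv j, xv j ^ 2, yv j ^ 2, xv j ^ 3, yv j ^ 3]

/-- The images of the `basisVec j` under the exchange of `xⱼ` and `yⱼ`. -/
def basisVecSwap (j : Fin 3) : Fin 8 → PolyVm 3 :=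
  ![1, yv j ^ 4 - xv j ^ 4, yv j, xv j, yv j ^ 2, xv j ^ 2, yv j ^ 3, xv j ^ 3]

/-- A product of basis vectors, symmetrized under the simultaneous exchange of the `xᵢ`
and `yᵢ`. -/
def symProd (b : Fin 8 × Fin 8 × Fin 8) (i j k : Fin 3) : PolyVm 3 :=
  basisVec i b.1 * basisVec j b.2.1 * basisVec k b.2.2 +
    basisVecSwap i b.1 * basisVecSwap j b.2.1 * basisVecSwap k b.2.2

/-- Representatives of the weight zero products under permutation and exchange. -/
def prodReps : List (Fin 8 × Fin 8 × Fin 8) :=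
  [(0, 0, 0), (0, 0, 1), (0, 2, 3), (0, 2, 6), (0, 4, 4), (0, 4, 5), (0, 6, 7), (0, 1, 1),
    (2, 2, 4), (2, 2, 5), (2, 3, 1), (2, 4, 7), (2, 5, 7), (2, 6, 1), (4, 4, 1), (4, 5, 1), (4, 6, 6), (4, 7, 7),
    (6, 7, 1), (1, 1, 1)]

set_option maxHeartbeats 1000000 in
lemma symProd_mem_of_mem_prodReps {S : Submodule P43 (PolyVm 3)}
    (hS : ∀ n i j k, i ≠ j → i ≠ k → j ≠ k → invForm n i j k ∈ S)
    {i j k : Fin 3} (hij : i ≠ j) (hik : i ≠ k) (hjk : j ≠ k) :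
    ∀ b ∈ prodReps, symProd b i j k ∈ S := by
  simp only [prodReps, List.forall_mem_cons, List.not_mem_nil, false_imp_iff, implies_true, and_true]
  refine ⟨
    mem_of_eq
      ((2 : P43) • invForm 0 i j k) ?_ ?_,
    mem_of_eq 0 ?_ ?_,
    mem_of_eq
      (invForm 1 j k i) ?_ ?_,
    mem_of_eq
      (invForm 6 k j i) ?_ ?_,
    mem_of_eq
      (invForm 4 j k i) ?_ ?_,
    mem_of_eq
      (invForm 5 j k i + (-(2 * qGen j * qGen k)) • invForm 0 i j k) ?_ ?_,
    mem_of_eq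
      (invForm 9 j k i + (-(3 * qGen j * qGen k)) • invForm 1 j k i) ?_ ?_,
    mem_of_eq
      ((2 * pGen j * pGen k) • invForm 0 i j k + (-4 : P43) • invForm 16 j k i +
        (-(8 * qGen j ^ 2 * qGen k ^ 2)) • invForm 0 i j k +
        (16 * qGen j * qGen k) • invForm 5 j k i) ?_ ?_,
    mem_of_eq
      (invForm 2 k i j) ?_ ?_,
    mem_of_eq
      (invForm 3 k i j + (-qGen k) • invForm 1 i j k) ?_ ?_,
    mem_of_eq
      ((-pGen k) • invForm 1 i j k + (2 : P43) • invForm 10 k i j +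
        (-(2 * qGen k)) • invForm 2 k i j) ?_ ?_,
    mem_of_eq
      (invForm 8 k j i + (-(qGen j * qGen k)) • invForm 1 i k j +
        (-qGen k) • invForm 3 j i k) ?_ ?_,
    mem_of_eq
      (invForm 7 k j i + (-qGen j) • invForm 6 k i j) ?_ ?_,
    mem_of_eq
      (pGen k • invForm 6 j i k + (-2 : P43) • invForm 15 k j i +
        (4 * qGen j * qGen k) • invForm 3 k i j + (2 * qGen k) • invForm 8 j k i +
        (-(2 * qGen j * qGen k ^ 2)) • invForm 1 i j k) ?_ ?_,
    mem_of_eq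
      (pGen k • invForm 4 i j k + (-2 : P43) • invForm 14 k i j +
        (-(12 * qGen i * qGen j * qGen k ^ 2)) • invForm 0 i j k +
        (2 * qGen k ^ 2) • invForm 5 i j k + (4 * qGen j * qGen k) • invForm 5 i k j +
        (4 * qGen i * qGen k) • invForm 5 j k i) ?_ ?_,
    mem_of_eq
      ((-pGen k) • invForm 5 i j k + (2 : P43) • invForm 13 k i j +
        (-(2 * qGen j * qGen k)) • invForm 4 i k j +
        (-(2 * qGen i * qGen k)) • invForm 4 j k i) ?_ ?_,
    mem_of_eq
      (invForm 11 j k i + (-(qGen i * qGen j * qGen k)) • invForm 1 j k i) ?_ ?_,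
    mem_of_eq
      (invForm 12 j k i + (-(qGen i * qGen k)) • invForm 6 j k i +
        (-qGen k) • invForm 7 j i k) ?_ ?_,
    mem_of_eq
      ((-pGen k) • invForm 9 i j k + (qGen i * qGen j * pGen k) • invForm 1 i j k +
        (2 : P43) • invForm 17 k i j + (-(2 * qGen i * qGen j * qGen k)) • invForm 2 k i j +
        (-(2 * qGen j * qGen k)) • invForm 7 i k j + (2 * qGen j * qGen k ^ 2) • invForm 6 i j k +
        (-(2 * qGen i * qGen k)) • invForm 7 j k i + (2 * qGen i * qGen k ^ 2) • invForm 6 j i k +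
        (-(2 * qGen i * qGen j)) • invForm 10 k i j) ?_ ?_,
    mem_of_eq 0 ?_ ?_⟩
  all_goals first
    | (repeat' with_reducible first | apply S.zero_mem | apply S.add_mem | apply S.smul_mem
       all_goals
         with_reducible apply hS
         all_goals first | assumption | (symm; assumption))
    | (simp [symProd, basisVec, basisVecSwap, invForm, uPoly, pGen, qGen, Subalgebra.smul_def]
       done)
    | (simp [symProd, basisVec, basisVecSwap, invForm, uPoly, pGen, qGen, Subalgebra.smul_def]
       ring1)

lemma hasForm_of_isCosetReps3 {S : Submodule P43 (PolyVm 3)} {n : Fin 18} {α : Fin 3 → ℕ}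
    {D : Set (Equiv.Perm (Fin 3))} (hD : IsCosetReps3 α D) (w : Equiv.Perm (Fin 3))
    (hw : ∀ u ∈ mStab3 α, u = 1 ∨ u = w)
    (hrep : ∀ s ∈ D, invForm n (s 0) (s 1) (s 2) ∈ S)
    (hswap : ∀ i j k, i ≠ j → i ≠ k → j ≠ k → invForm n i j k ∈ S →
      invForm n (![i, j, k] (w 0)) (![i, j, k] (w 1)) (![i, j, k] (w 2)) ∈ S) :
    HasForm S n := by
  intro i j k hij hik hjk
  obtain ⟨t, rfl, rfl, rfl⟩ : ∃ t : Equiv.Perm (Fin 3), t 0 = i ∧ t 1 = j ∧ t 2 = k := by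
    decide +revert
  obtain ⟨s, ⟨hs, hu⟩, -⟩ := hD t
  rcases hw _ hu with h | h
  · rw [inv_mul_eq_one] at h
    exact h ▸ hrep s hs
  · obtain rfl : t = s * w := by rw [← h]; group
    have hs3 : ![s 0, s 1, s 2] = s := by ext i; fin_cases i <;> rfl
    have := hswap (s 0) (s 1) (s 2) (s.injective.ne (by decide)) (s.injective.ne (by decide))
      (s.injective.ne (by decide)) (hrep s hs)
    rwa [hs3] at this

/-- The multidegrees of the listed invariants. -/
def multidegree : Fin 18 → Fin 3 → ℕ :=
  ![![0, 0, 0], ![1, 1, 0], ![2, 1, 1], ![2, 1, 1], ![2, 2, 0], ![2, 2, 0], ![3, 1, 0],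
    ![3, 2, 1], ![3, 2, 1], ![3, 3, 0], ![4, 1, 1], ![3, 3, 2], ![3, 3, 2], ![4, 2, 2],
    ![4, 2, 2], ![4, 3, 1], ![4, 4, 0], ![4, 3, 3]]

lemma dihListD8_get_snd (n : Fin 18) : (dihListD8.get n).2 = multidegree n := by
  fin_cases n <;> rfl


lemma invForm_swap_fst {n : Fin 18} (hn : n ∈ [1, 4, 5, 9, 11, 16]) (i j k : Fin 3) :
    invForm n j i k = invForm n i j k := by
  simp only [List.mem_cons, List.not_mem_nil, or_false] at hn
  rcases hn with rfl | rfl | rfl | rfl | rfl | rfl <;> simp [invForm, uPoly] <;> ring1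

lemma invForm_swap_snd {n : Fin 18} (hn : n ∈ [2, 3, 14]) (i j k : Fin 3) :
    invForm n i k j = invForm n i j k := by
  simp only [List.mem_cons, List.not_mem_nil, or_false] at hn
  rcases hn with rfl | rfl | rfl <;> simp [invForm, uPoly] <;> ring1

lemma invForm_10_swap_snd (i j k : Fin 3) :
    invForm 10 i k j =
      (2 * qGen i) • invForm 2 i j k + (-1 : P43) • invForm 10 i j k + pGen i • invForm 1
        j k i := by
  simp [invForm, uPoly, pGen, qGen, Subalgebra.smul_def]; ring1

lemma invForm_12_swap_fst (i j k : Fin 3) :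
    invForm 12 j i k =
      (qGen i * qGen k) • invForm 6 j i k + qGen i • invForm 7 j k i + invForm 12 i j k +
        (-(qGen j * qGen k)) • invForm 6 i j k + (-qGen j) • invForm 7 i k j := by
  simp [invForm, uPoly, qGen, Subalgebra.smul_def]; ring1

lemma invForm_13_swap_snd (i j k : Fin 3) :
    invForm 13 i k j =
      (2 * qGen i * qGen k) • invForm 4 i j k + (2 * qGen i * qGen j) • invForm 4 i k j +
        (-1 : P43) • invForm 13 i j k + pGen i • invForm 5 j k i := by
  simp [invForm, uPoly, pGen, qGen, Subalgebra.smul_def]; ring1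

lemma invForm_17_swap_snd (i j k : Fin 3) :
    invForm 17 i k j =
      (4 * qGen i * qGen j * qGen k) • invForm 2 i j k + (2 * qGen i * qGen k) • invForm 7
        j i k + (-(2 * qGen i ^ 2 * qGen k)) • invForm 6 j k i + (2 * qGen i * qGen j) •
        invForm 7 k i j + (-(2 * qGen i ^ 2 * qGen j)) • invForm 6 k j i + (-1 : P43) •
        invForm 17 i j k + pGen i • invForm 9 j k i := by
  simp [invForm, uPoly, pGen, qGen, Subalgebra.smul_def]; ring1

lemma hasForm_all {S : Submodule P43 (PolyVm 3)} {D : Fin 18 → Set (Equiv.Perm (Fin 3))}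
    (hD : ∀ n, IsCosetReps3 (multidegree n) (D n))
    (hrep : ∀ n, ∀ s ∈ D n, invForm n (s 0) (s 1) (s 2) ∈ S) (n : Fin 18) : HasForm S n := by
  have h_one : ∀ n, (∀ u ∈ mStab3 (multidegree n), u = 1) → HasForm S n := fun n hn =>
    hasForm_of_isCosetReps3 (hD n) 1 (fun u hu => Or.inl (hn u hu)) (hrep n)
      fun i j k _ _ _ h => h
  have h_fst : ∀ n, (∀ u ∈ mStab3 (multidegree n), u = 1 ∨ u = Equiv.swap 0 1) →
      (∀ i j k, i ≠ j → i ≠ k → j ≠ k → invForm n i j k ∈ S → invForm n j i k ∈ S) →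
      HasForm S n := fun n hn h => hasForm_of_isCosetReps3 (hD n) _ hn (hrep n) h
  have h_snd : ∀ n, (∀ u ∈ mStab3 (multidegree n), u = 1 ∨ u = Equiv.swap 1 2) →
      (∀ i j k, i ≠ j → i ≠ k → j ≠ k → invForm n i j k ∈ S → invForm n i k j ∈ S) →
      HasForm S n := fun n hn h => hasForm_of_isCosetReps3 (hD n) _ hn (hrep n) h
  have h0 : HasForm S 0 := by
    intro i j k _ _ _
    obtain ⟨s, ⟨hs, -⟩, -⟩ := hD 0 1
    exact mem_of_eq _ (by simp [invForm]) (hrep 0 s hs)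
  have h6 : HasForm S 6 := h_one 6 (by simp only [mStab3, Set.mem_ofPred_eq]; decide)
  have h7 : HasForm S 7 := h_one 7 (by simp only [mStab3, Set.mem_ofPred_eq]; decide)
  have h8 : HasForm S 8 := h_one 8 (by simp only [mStab3, Set.mem_ofPred_eq]; decide)
  have h15 : HasForm S 15 := h_one 15 (by simp only [mStab3, Set.mem_ofPred_eq]; decide)
  have h1 : HasForm S 1 := by
    refine h_fst 1 (by simp only [mStab3, Set.mem_ofPred_eq]; decide) fun i j k hij hik hjk h => ?_
    rwa [invForm_swap_fst (by decide)]
  have h4 : HasForm S 4 := by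
    refine h_fst 4 (by simp only [mStab3, Set.mem_ofPred_eq]; decide) fun i j k hij hik hjk h => ?_
    rwa [invForm_swap_fst (by decide)]
  have h5 : HasForm S 5 := by
    refine h_fst 5 (by simp only [mStab3, Set.mem_ofPred_eq]; decide) fun i j k hij hik hjk h => ?_
    rwa [invForm_swap_fst (by decide)]
  have h9 : HasForm S 9 := by
    refine h_fst 9 (by simp only [mStab3, Set.mem_ofPred_eq]; decide) fun i j k hij hik hjk h => ?_
    rwa [invForm_swap_fst (by decide)]
  have h11 : HasForm S 11 := by
    refine h_fst 11 (by simp only [mStab3, Set.mem_ofPred_eq]; decide) fun i j k hij hik hjk h => ?_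
    rwa [invForm_swap_fst (by decide)]
  have h16 : HasForm S 16 := by
    refine h_fst 16 (by simp only [mStab3, Set.mem_ofPred_eq]; decide) fun i j k hij hik hjk h => ?_
    rwa [invForm_swap_fst (by decide)]
  have h2 : HasForm S 2 := by
    refine h_snd 2 (by simp only [mStab3, Set.mem_ofPred_eq]; decide) fun i j k hij hik hjk h => ?_
    rwa [invForm_swap_snd (by decide)]
  have h3 : HasForm S 3 := by
    refine h_snd 3 (by simp only [mStab3, Set.mem_ofPred_eq]; decide) fun i j k hij hik hjk h => ?_
    rwa [invForm_swap_snd (by decide)]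
  have h14 : HasForm S 14 := by
    refine h_snd 14 (by simp only [mStab3, Set.mem_ofPred_eq]; decide) fun i j k hij hik hjk h => ?_
    rwa [invForm_swap_snd (by decide)]
  have h10 : HasForm S 10 := by
    refine h_snd 10 (by simp only [mStab3, Set.mem_ofPred_eq]; decide) fun i j k hij hik hjk h => ?_
    rw [invForm_10_swap_snd]
    exact (S.add_mem (S.add_mem (S.smul_mem _ (h2 _ _ _ hij hik hjk)) (S.smul_mem _ h))
      (S.smul_mem _ (h1 _ _ _ hjk hij.symm hik.symm)))
  have h12 : HasForm S 12 := by
    refine h_fst 12 (by simp only [mStab3, Set.mem_ofPred_eq]; decide) fun i j k hij hik hjk h => ?_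
    rw [invForm_12_swap_fst]
    exact (S.add_mem (S.add_mem (S.add_mem (S.add_mem (S.smul_mem _ (h6 _ _ _ hij.symm hjk
      hik)) (S.smul_mem _ (h7 _ _ _ hjk hij.symm hik.symm))) h) (S.smul_mem _ (h6 _ _ _
      hij hik hjk))) (S.smul_mem _ (h7 _ _ _ hik hij hjk.symm)))
  have h13 : HasForm S 13 := by
    refine h_snd 13 (by simp only [mStab3, Set.mem_ofPred_eq]; decide) fun i j k hij hik hjk h => ?_
    rw [invForm_13_swap_snd]
    exact (S.add_mem (S.add_mem (S.add_mem (S.smul_mem _ (h4 _ _ _ hij hik hjk))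
      (S.smul_mem _ (h4 _ _ _ hik hij hjk.symm))) (S.smul_mem _ h)) (S.smul_mem _ (h5 _ _
      _ hjk hij.symm hik.symm)))
  have h17 : HasForm S 17 := by
    refine h_snd 17 (by simp only [mStab3, Set.mem_ofPred_eq]; decide) fun i j k hij hik hjk h => ?_
    rw [invForm_17_swap_snd]
    exact (S.add_mem (S.add_mem (S.add_mem (S.add_mem (S.add_mem (S.add_mem (S.smul_mem _
      (h2 _ _ _ hij hik hjk)) (S.smul_mem _ (h7 _ _ _ hij.symm hjk hik))) (S.smul_mem _
      (h6 _ _ _ hjk hij.symm hik.symm))) (S.smul_mem _ (h7 _ _ _ hik.symm hjk.symm hij)))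
      (S.smul_mem _ (h6 _ _ _ hjk.symm hik.symm hij.symm))) (S.smul_mem _ h)) (S.smul_mem
      _ (h9 _ _ _ hjk hij.symm hik.symm)))
  fin_cases n
  exacts [h0, h1, h2, h3, h4, h5, h6, h7, h8, h9, h10, h11, h12, h13, h14, h15, h16, h17]

/-! ### Symmetrized products of weight zero -/

/-- The weights of the basis vectors under `diag(i, -i)`. -/
def weight : Fin 8 → ℕ := ![0, 0, 1, 3, 2, 2, 3, 1]

/-- The effect on the indices of basis vectors of the exchange of `xⱼ` and `yⱼ`. -/
def swapIdx : Fin 8 → Fin 8 := ![0, 1, 3, 2, 5, 4, 7, 6]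

/-- The signs of basis vectors under the exchange of `xⱼ` and `yⱼ`. -/
def swapSign : Fin 8 → ℤ := ![1, -1, 1, 1, 1, 1, 1, 1]

lemma basisVecSwap_eq (j : Fin 3) (a : Fin 8) :
    basisVecSwap j a = (swapSign a : PolyVm 3) * basisVec j (swapIdx a) := by
  fin_cases a <;> simp [basisVecSwap, basisVec, swapSign, swapIdx]

lemma basisVecSwap_swapIdx (j : Fin 3) (a : Fin 8) :
    basisVecSwap j (swapIdx a) = (swapSign a : PolyVm 3) * basisVec j a := by
  fin_cases a <;> simp [basisVecSwap, basisVec, swapSign, swapIdx]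

/-- The weight of a product of basis vectors. -/
def tripleWeight (b : Fin 8 × Fin 8 × Fin 8) : ℕ := weight b.1 + weight b.2.1 + weight b.2.2

/-- The exchange of all `xᵢ` and `yᵢ` on indices of products. -/
def tripleSwap (b : Fin 8 × Fin 8 × Fin 8) : Fin 8 × Fin 8 × Fin 8 :=
  (swapIdx b.1, swapIdx b.2.1, swapIdx b.2.2)

/-- The signs of products under the exchange of all `xᵢ` and `yᵢ`. -/
def tripleSign (b : Fin 8 × Fin 8 × Fin 8) : ℤ := swapSign b.1 * swapSign b.2.1 * swapSign b.2.2

/-- The product of basis vectors with index `b`. -/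
def prodVec (b : Fin 8 × Fin 8 × Fin 8) : PolyVm 3 :=
  basisVec 0 b.1 * basisVec 1 b.2.1 * basisVec 2 b.2.2

lemma swapSign_mul_self (a : Fin 8) : swapSign a * swapSign a = 1 := by
  decide +revert

lemma symProd_eq (b : Fin 8 × Fin 8 × Fin 8) :
    symProd b 0 1 2 = prodVec b + (tripleSign b : PolyVm 3) * prodVec (tripleSwap b) := by
  simp only [symProd, basisVecSwap_eq, prodVec, tripleSign, tripleSwap]
  push_cast
  ring

lemma symProd_eq_sign_mul (b : Fin 8 × Fin 8 × Fin 8) (i j k : Fin 3) :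
    symProd b i j k = (tripleSign b : PolyVm 3) * symProd (tripleSwap b) i j k := by
  have h (a : Fin 8) : (swapSign a : PolyVm 3) * swapSign a = 1 := by
    exact_mod_cast congrArg (Int.cast : ℤ → PolyVm 3) (swapSign_mul_self a)
  simp only [symProd, basisVecSwap_swapIdx, tripleSwap]
  simp only [basisVecSwap_eq, tripleSign]
  push_cast
  linear_combination (-(basisVec i b.1 * basisVec j b.2.1 * basisVec k b.2.2)) *
    ((swapSign b.2.1) ^ 2 * (swapSign b.2.2) ^ 2 * h b.1 + (swapSign b.2.2) ^ 2 * h b.2.1 + h b.2.2)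

/-- The permutations of a triple. -/
def triplePerms (b : Fin 8 × Fin 8 × Fin 8) : List (Fin 8 × Fin 8 × Fin 8) :=
  [b, (b.1, b.2.2, b.2.1), (b.2.1, b.1, b.2.2), (b.2.1, b.2.2, b.1), (b.2.2, b.1, b.2.1),
    (b.2.2, b.2.1, b.1)]

set_option synthInstance.maxHeartbeats 200000 in
set_option synthInstance.maxSize 1000 in
lemma exists_mem_prodReps : ∀ b, tripleWeight b % 4 = 0 →
    (∃ r ∈ triplePerms b, r ∈ prodReps) ∨ ∃ r ∈ triplePerms (tripleSwap b), r ∈ prodReps := by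
  decide +kernel

lemma symProd_mem {S : Submodule P43 (PolyVm 3)} (hS : ∀ n, HasForm S n)
    {b : Fin 8 × Fin 8 × Fin 8} (hb : tripleWeight b % 4 = 0) : symProd b 0 1 2 ∈ S := by
  have key : ∀ b, (∃ r ∈ triplePerms b, r ∈ prodReps) → symProd b 0 1 2 ∈ S := by
    rintro ⟨a, b, c⟩ ⟨r, hr, hr'⟩
    have h := fun i j k hij hik hjk =>
      symProd_mem_of_mem_prodReps hS (i := i) (j := j) (k := k) hij hik hjk r hr'
    simp only [triplePerms, List.mem_cons, List.not_mem_nil, or_false] at hr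
    rcases hr with rfl | rfl | rfl | rfl | rfl | rfl
    · exact h 0 1 2 (by decide) (by decide) (by decide)
    · exact mem_of_eq _ (by simp only [symProd]; ring1)
        (h 0 2 1 (by decide) (by decide) (by decide))
    · exact mem_of_eq _ (by simp only [symProd]; ring1)
        (h 1 0 2 (by decide) (by decide) (by decide))
    · exact mem_of_eq _ (by simp only [symProd]; ring1)
        (h 1 2 0 (by decide) (by decide) (by decide))
    · exact mem_of_eq _ (by simp only [symProd]; ring1)
        (h 2 0 1 (by decide) (by decide) (by decide))
    · exact mem_of_eq _ (by simp only [symProd]; ring1)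
        (h 2 1 0 (by decide) (by decide) (by decide))
  rcases exists_mem_prodReps b hb with h | h
  · exact key _ h
  · rw [symProd_eq_sign_mul]
    exact P43_smul_mem S (intCast_mem P43 _) (key _ h)

/-! ### Linear independence of the products of basis vectors -/

/-- The automorphism `xⱼ ↦ i xⱼ`, `yⱼ ↦ -i yⱼ`, fixing the other variables. -/
def rotAct (j : Fin 3) : PolyVm 3 →ₐ[ℂ] PolyVm 3 :=
  aeval fun p => if p.2 = j then (if p.1 = 0 then C Complex.I * xv j else -(C Complex.I * yv j))
    else X p

/-- The automorphism exchanging `xⱼ` and `yⱼ`, fixing the other variables. -/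
def swapAct (j : Fin 3) : PolyVm 3 →ₐ[ℂ] PolyVm 3 :=
  aeval fun p => if p.2 = j then (if p.1 = 0 then yv j else xv j) else X p

lemma rotAct_xv (j i : Fin 3) : rotAct j (xv i) = if i = j then C Complex.I * xv j else xv i := by
  simp [rotAct, xv]

lemma rotAct_yv (j i : Fin 3) :
    rotAct j (yv i) = if i = j then -(C Complex.I * yv j) else yv i := by
  simp [rotAct, yv]

lemma swapAct_xv (j i : Fin 3) : swapAct j (xv i) = if i = j then yv j else xv i := by
  simp [swapAct, xv]

lemma swapAct_yv (j i : Fin 3) : swapAct j (yv i) = if i = j then xv j else yv i := by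
  simp [swapAct, yv]

lemma C_I_sq : (C Complex.I : PolyVm 3) ^ 2 = -1 := by
  rw [← C_pow, Complex.I_sq, C_neg, C_1]

/-- The polynomials fixed by `rotAct j` and `swapAct j`. -/
def fixedAt (j : Fin 3) : Subalgebra ℂ (PolyVm 3) :=
  AlgHom.equalizer (rotAct j) (AlgHom.id ℂ _) ⊓ AlgHom.equalizer (swapAct j) (AlgHom.id ℂ _)

lemma mem_fixedAt {j : Fin 3} {f : PolyVm 3} :
    f ∈ fixedAt j ↔ rotAct j f = f ∧ swapAct j f = f := Iff.rfl

lemma P43_le_fixedAt (j : Fin 3) : P43 ≤ fixedAt j := by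
  refine P43_le_of_generators (fun i => ?_) fun i => ?_ <;> rw [mem_fixedAt] <;>
    simp only [map_add, map_pow, map_mul, rotAct_xv, rotAct_yv, swapAct_xv, swapAct_yv] <;>
    split_ifs with h
  · subst h
    refine ⟨?_, by ring⟩
    linear_combination (xv i ^ 4 + yv i ^ 4) * ((C Complex.I) ^ 2 - 1) * C_I_sq
  · simp
  · subst h
    refine ⟨?_, by ring⟩
    linear_combination -(xv i * yv i) * C_I_sq
  · simp

lemma basisVec_mem_fixedAt {i j : Fin 3} (h : i ≠ j) (a : Fin 8) : basisVec i a ∈ fixedAt j := by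
  have hx : xv i ∈ fixedAt j := by simp [mem_fixedAt, rotAct_xv, swapAct_xv, h]
  have hy : yv i ∈ fixedAt j := by simp [mem_fixedAt, rotAct_yv, swapAct_yv, h]
  have := (fixedAt j).sub_mem (pow_mem hx 4) (pow_mem hy 4)
  fin_cases a
  exacts [one_mem _, this, hx, hy, pow_mem hx 2, pow_mem hy 2, pow_mem hx 3, pow_mem hy 3]

lemma xv_ne_zero (j : Fin 3) : xv j ≠ 0 := X_ne_zero _

lemma pow_sub_pow_ne_zero (j : Fin 3) : xv j ^ 4 - yv j ^ 4 ≠ 0 := by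
  intro h
  have := congrArg (eval fun p : Fin 2 × Fin 3 => if p.1 = 0 then (1 : ℂ) else 0) h
  simp [xv, yv] at this

/-- Polynomials fixed by `rotAct j` and `swapAct j` satisfy no linear relation with respect to
the `basisVec j`. -/
lemma eq_zero_of_sum_mul_basisVec_eq_zero {j : Fin 3} {c : Fin 8 → PolyVm 3}
    (hc : ∀ a, c a ∈ fixedAt j) (h : ∑ a, c a * basisVec j a = 0) (a : Fin 8) : c a = 0 := by
  have hr a : rotAct j (c a) = c a := (hc a).1
  have hs a : swapAct j (c a) = c a := (hc a).2
  have hI := C_I_sq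
  have hd := pow_sub_pow_ne_zero j
  have hx := xv_ne_zero j
  simp only [Fin.sum_univ_eight, basisVec, Matrix.cons_val] at h
  set ι : PolyVm 3 := C Complex.I with hι
  have hrι : rotAct j ι = ι := (rotAct j).commutes _
  have rx : rotAct j (xv j) = ι * xv j := by simp [rotAct_xv, hι]
  have ry : rotAct j (yv j) = -(ι * yv j) := by simp [rotAct_yv, hι]
  have rx2 : rotAct j (xv j ^ 2) = -xv j ^ 2 := by
    rw [map_pow, rx]; linear_combination xv j ^ 2 * hI
  have ry2 : rotAct j (yv j ^ 2) = -yv j ^ 2 := by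
    rw [map_pow, ry]; linear_combination yv j ^ 2 * hI
  have rx3 : rotAct j (xv j ^ 3) = -(ι * xv j ^ 3) := by
    rw [map_pow, rx]; linear_combination ι * xv j ^ 3 * hI
  have ry3 : rotAct j (yv j ^ 3) = ι * yv j ^ 3 := by
    rw [map_pow, ry]; linear_combination -ι * yv j ^ 3 * hI
  have rd : rotAct j (xv j ^ 4 - yv j ^ 4) = xv j ^ 4 - yv j ^ 4 := by
    rw [map_sub, map_pow, map_pow, rx, ry]
    linear_combination (xv j ^ 4 - yv j ^ 4) * (ι ^ 2 - 1) * hI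
  have h1 := congrArg (rotAct j) h
  simp only [map_add, map_mul, map_zero, map_one, hr, rx, ry, rx2, ry2, rx3, ry3, rd] at h1
  have h2 := congrArg (rotAct j) h1
  simp only [map_add, map_mul, map_zero, map_one, map_neg, hr, hrι, rx, ry, rx2, ry2, rx3, ry3,
    rd] at h2
  have h3 := congrArg (rotAct j) h2
  simp only [map_add, map_mul, map_zero, map_one, map_neg, hr, hrι, rx, ry, rx2, ry2, rx3, ry3,
    rd] at h3
  have h4 : (4 : PolyVm 3) ≠ 0 := by norm_num
  have hA : c 0 + c 1 * (xv j ^ 4 - yv j ^ 4) = 0 := mul_left_cancel₀ h4 <| by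
    linear_combination h + h1 + h2 + h3 - ((c 2 * xv j + c 7 * yv j ^ 3) * (1 + ι) +
      (c 3 * yv j + c 6 * xv j ^ 3) * (1 - ι)) * hI
  have hB : c 2 * xv j + c 7 * yv j ^ 3 = 0 := mul_left_cancel₀ h4 <| by
    linear_combination h - ι * h1 - h2 + ι * h3 + ((c 2 * xv j + c 7 * yv j ^ 3) * (3 - ι ^ 2) -
      (c 3 * yv j + c 6 * xv j ^ 3) * (1 - ι ^ 2)) * hI
  have hC : c 4 * xv j ^ 2 + c 5 * yv j ^ 2 = 0 := mul_left_cancel₀ h4 <| by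
    linear_combination h - h1 + h2 - h3 - ((c 2 * xv j + c 7 * yv j ^ 3) * (1 - ι) +
      (c 3 * yv j + c 6 * xv j ^ 3) * (1 + ι)) * hI
  have hD : c 3 * yv j + c 6 * xv j ^ 3 = 0 := mul_left_cancel₀ h4 <| by
    linear_combination h + ι * h1 - h2 - ι * h3 + ((c 3 * yv j + c 6 * xv j ^ 3) * (3 - ι ^ 2) -
      (c 2 * xv j + c 7 * yv j ^ 3) * (1 - ι ^ 2)) * hI
  have sx : swapAct j (xv j) = yv j := by simp [swapAct_xv]
  have sy : swapAct j (yv j) = xv j := by simp [swapAct_yv]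
  have hA' := congrArg (swapAct j) hA
  have hB' := congrArg (swapAct j) hB
  have hC' := congrArg (swapAct j) hC
  have hD' := congrArg (swapAct j) hD
  simp only [map_add, map_mul, map_sub, map_pow, map_zero, hs, sx, sy] at hA' hB' hC' hD'
  have c1 : c 1 = 0 := by
    refine (mul_eq_zero.1 (?_ : c 1 * (2 * (xv j ^ 4 - yv j ^ 4)) = 0)).resolve_right
      (mul_ne_zero two_ne_zero hd)
    linear_combination hA - hA'
  have c0 : c 0 = 0 := by simpa [c1] using hA
  have c7 : c 7 = 0 := by
    refine (mul_eq_zero.1 (?_ : c 7 * (xv j ^ 4 - yv j ^ 4) = 0)).resolve_right hd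
    linear_combination xv j * hB' - yv j * hB
  have c2 : c 2 = 0 := by simpa [c7, hx] using hB
  have c5 : c 5 = 0 := by
    refine (mul_eq_zero.1 (?_ : c 5 * (xv j ^ 4 - yv j ^ 4) = 0)).resolve_right hd
    linear_combination xv j ^ 2 * hC' - yv j ^ 2 * hC
  have c4 : c 4 = 0 := by simpa [c5, hx] using hC
  have c6 : c 6 = 0 := by
    refine (mul_eq_zero.1 (?_ : c 6 * (xv j ^ 4 - yv j ^ 4) = 0)).resolve_right hd
    linear_combination xv j * hD - yv j * hD'
  have c3 : c 3 = 0 := by simpa [c6, hx] using hD'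
  fin_cases a <;> assumption

lemma eq_zero_of_sum_mul_prodVec_eq_zero {c : Fin 8 × Fin 8 × Fin 8 → PolyVm 3}
    (hc : ∀ b, c b ∈ P43) (h : ∑ b, c b * prodVec b = 0) (b : Fin 8 × Fin 8 × Fin 8) :
    c b = 0 := by
  have hf j b : c b ∈ fixedAt j := P43_le_fixedAt j (hc b)
  simp only [Fintype.sum_prod_type, prodVec] at h
  have h0 a : ∑ b, (∑ d, c (a, b, d) * basisVec 2 d) * basisVec 1 b = 0 := by
    refine eq_zero_of_sum_mul_basisVec_eq_zero (j := 0)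
      (c := fun a => ∑ b, (∑ d, c (a, b, d) * basisVec 2 d) * basisVec 1 b) (fun a => ?_) ?_ a
    · exact sum_mem fun b _ => mul_mem (sum_mem fun d _ =>
        mul_mem (hf 0 _) (basisVec_mem_fixedAt (by decide) _)) (basisVec_mem_fixedAt (by decide) _)
    · simp only [Finset.sum_mul]
      rw [← h]
      exact Finset.sum_congr rfl fun _ _ => Finset.sum_congr rfl fun _ _ =>
        Finset.sum_congr rfl fun _ _ => by ring
  have h1 a b : ∑ d, c (a, b, d) * basisVec 2 d = 0 :=
    eq_zero_of_sum_mul_basisVec_eq_zero (j := 1)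
      (c := fun b => ∑ d, c (a, b, d) * basisVec 2 d)
      (fun b => sum_mem fun d _ => mul_mem (hf 1 _) (basisVec_mem_fixedAt (by decide) _)) (h0 a) b
  exact eq_zero_of_sum_mul_basisVec_eq_zero (j := 2) (c := fun d => c (b.1, b.2.1, d))
    (fun d => hf 2 _) (h1 _ _) b.2.2

/-- The value of a triple of digits in base eight. -/
def tripleCode (b : Fin 8 × Fin 8 × Fin 8) : ℕ := 64 * b.1 + 8 * b.2.1 + b.2.2

/-- Representatives under the exchange of the weight zero products with non-zero
symmetrization. -/
def symReps : Finset (Fin 8 × Fin 8 × Fin 8) :=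
  Finset.univ.filter fun b => tripleWeight b % 4 = 0 ∧ tripleCode b ≤ tripleCode (tripleSwap b) ∧
    (tripleSwap b = b → tripleSign b = 1)

lemma card_symReps : symReps.card = 64 := by decide +kernel

lemma tripleSwap_tripleSwap : ∀ b, tripleSwap (tripleSwap b) = b := by decide +kernel

lemma tripleSign_tripleSwap : ∀ b, tripleSign (tripleSwap b) = tripleSign b := by decide +kernel

lemma tripleSwap_eq_self_of_mem : ∀ b ∈ symReps, tripleSwap b ∈ symReps →
    tripleSwap b = b ∧ tripleSign b = 1 := by decide +kernel

lemma linearIndependent_symProd :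
    LinearIndependent P43 fun b : symReps => symProd b.1 0 1 2 := by
  rw [Fintype.linearIndependent_iff]
  intro d hd b
  let D : Fin 8 × Fin 8 × Fin 8 → PolyVm 3 := fun b => if hb : b ∈ symReps then d ⟨b, hb⟩ else 0
  have hD b : D b ∈ P43 := by
    by_cases hb : b ∈ symReps
    · simp [D, hb]
    · simp [D, hb, P43.zero_mem]
  have hsum : ∑ b, D b * symProd b 0 1 2 = 0 := by
    rw [← hd, ← Finset.sum_subset (Finset.subset_univ symReps), ← Finset.sum_coe_sort]
    · exact Finset.sum_congr rfl fun b _ => by simp [D, Subalgebra.smul_def]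
    · intro b _ hb
      simp [D, hb]
  have hsum' : ∑ b, (D b + D (tripleSwap b) * tripleSign b) * prodVec b = 0 := by
    rw [← hsum]
    simp only [symProd_eq, mul_add, add_mul, Finset.sum_add_distrib]
    rw [← Function.Bijective.sum_comp (Function.Involutive.bijective tripleSwap_tripleSwap)
      fun b => D b * ((tripleSign b : PolyVm 3) * prodVec (tripleSwap b))]
    simp only [tripleSwap_tripleSwap, tripleSign_tripleSwap, mul_assoc]
  have hb := eq_zero_of_sum_mul_prodVec_eq_zero (c := fun b => D b + D (tripleSwap b) * tripleSign b)
    (fun b => P43.add_mem (hD _) (P43.mul_mem (hD _) (intCast_mem P43 _))) hsum' b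
  have hDb : D b = d b := by simp [D]
  refine Subtype.ext ?_
  rw [← hDb, ZeroMemClass.coe_zero]
  by_cases h : tripleSwap b ∈ symReps
  · obtain ⟨h1, h2⟩ := tripleSwap_eq_self_of_mem b b.2 h
    simpa [h1, h2, ← two_mul] using hb
  · simpa [D, h] using hb

lemma linearIndependent_of_card_le {R M ι κ : Type*} [CommRing R] [Nontrivial R]
    [AddCommGroup M] [Module R M] [Fintype ι] [Fintype κ] {g : ι → M} {e : κ → M}
    (he : LinearIndependent R e) (heg : ∀ k, e k ∈ Submodule.span R (Set.range g))
    (hcard : Fintype.card ι ≤ Fintype.card κ) : LinearIndependent R g := by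
  rw [linearIndependent_iff_card_eq_finrank_span]
  have : Module.Finite R (Submodule.span R (Set.range g)) :=
    Module.Finite.span_of_finite R (Set.finite_range g)
  have he' : LinearIndependent R fun k => (⟨e k, heg k⟩ : Submodule.span R (Set.range g)) :=
    LinearIndependent.of_comp (Submodule.subtype _) he
  exact le_antisymm (hcard.trans he'.fintype_card_le_finrank) (finrank_range_le_card g)

lemma sum_card_image_multidegree :
    ∑ n, (Finset.univ.image fun s : Equiv.Perm (Fin 3) => multidegree n ∘ ⇑s⁻¹).card = 64 := by
  decide +kernel

lemma card_sigma_le {D : Fin 18 → Set (Equiv.Perm (Fin 3))}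
    (hD : ∀ n, IsCosetReps3 (multidegree n) (D n)) [∀ n, Fintype (D n)] :
    Fintype.card ((n : Fin 18) × D n) ≤ 64 := by
  rw [Fintype.card_sigma, ← sum_card_image_multidegree]
  refine Finset.sum_le_sum fun n _ => ?_
  rw [← Set.toFinset_card]
  refine Finset.card_le_card_of_injOn (fun s => multidegree n ∘ ⇑s⁻¹) (fun s _ => by simp) ?_
  intro s hs t ht h
  refine (hD n t).unique ⟨by simpa using hs, fun j => ?_⟩ ⟨by simpa using ht, fun j => by simp⟩
  simpa using congrFun h (t j)

/-! ### Invariants of the dihedral group -/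

lemma actG_mul {m : ℕ} (g h : Matrix (Fin 2) (Fin 2) ℂ) :
    actG (m := m) (g * h) = (actG h).comp (actG g) := by
  refine algHom_ext fun p => ?_
  simp only [actG, AlgHom.comp_apply, aeval_X, Matrix.mul_apply, Fin.sum_univ_two, map_add,
    map_smul, smul_add, smul_smul, add_smul]
  abel

lemma mem_invAlg_iff {m : ℕ} {S : Set (Matrix (Fin 2) (Fin 2) ℂ)} {f : PolyVm m} :
    f ∈ invAlg m S ↔ ∀ g ∈ S, actG g f = f := by
  refine ⟨fun h g hg => h g (Submonoid.subset_closure hg), fun h g hg => ?_⟩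
  induction hg using Submonoid.closure_induction with
  | mem g hg => exact h g hg
  | one =>
    have : actG (m := m) 1 = AlgHom.id ℂ _ := by
      refine algHom_ext fun p => ?_
      simp [actG, Matrix.one_apply]
    simp [this]
  | mul g₁ g₂ _ _ h₁ h₂ => rw [actG_mul, AlgHom.comp_apply, h₁, h₂]

lemma mem_dihedralInv_iff {f : PolyVm 3} :
    f ∈ dihedralInv 3 Complex.I ↔ actG (dMat Complex.I) f = f ∧ actG sMat f = f := by
  simp [dihedralInv, mem_invAlg_iff]

lemma actG_dMat_xv (i : Fin 3) : actG (dMat Complex.I) (xv i) = C Complex.I * xv i := by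
  simp [actG, dMat, xv, smul_eq_C_mul]

lemma actG_dMat_yv (i : Fin 3) : actG (dMat Complex.I) (yv i) = -(C Complex.I * yv i) := by
  simp [actG, dMat, yv, smul_eq_C_mul]

lemma actG_sMat_xv (i : Fin 3) : actG sMat (xv i) = yv i := by
  simp [actG, sMat, xv, yv]

lemma actG_sMat_yv (i : Fin 3) : actG sMat (yv i) = xv i := by
  simp [actG, sMat, xv, yv]

lemma uPoly_mem_dihedralInv (i j : Fin 3) : uPoly i j ∈ dihedralInv 3 Complex.I := by
  rw [mem_dihedralInv_iff]
  simp only [uPoly, map_add, map_mul, actG_dMat_xv, actG_dMat_yv, actG_sMat_xv, actG_sMat_yv]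
  refine ⟨?_, by ring⟩
  linear_combination -(xv i * yv j + xv j * yv i) * C_I_sq

lemma quartic_mem_dihedralInv (i j k l : Fin 3) :
    xv i * xv j * xv k * xv l + yv i * yv j * yv k * yv l ∈ dihedralInv 3 Complex.I := by
  rw [mem_dihedralInv_iff]
  simp only [map_add, map_mul, actG_dMat_xv, actG_dMat_yv, actG_sMat_xv, actG_sMat_yv]
  refine ⟨?_, by ring⟩
  linear_combination (xv i * xv j * xv k * xv l + yv i * yv j * yv k * yv l) *
    ((C Complex.I) ^ 2 - 1) * C_I_sq

lemma P43_le_dihedralInv : P43 ≤ dihedralInv 3 Complex.I := by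
  refine P43_le_of_generators (fun i => ?_) fun i => ?_
  · convert quartic_mem_dihedralInv i i i i using 1
    ring
  · convert (dihedralInv 3 Complex.I).smul_mem (uPoly_mem_dihedralInv i i) (1 / 2 : ℂ) using 1
    rw [uPoly, ← two_mul, smul_eq_C_mul, ← mul_assoc, ← map_ofNat C 2, ← C_mul]
    norm_num

lemma invForm_mem_dihedralInv (n : Fin 18) (i j k : Fin 3) :
    invForm n i j k ∈ dihedralInv 3 Complex.I := by
  have hu := uPoly_mem_dihedralInv
  have h310 : xv i ^ 3 * xv j + yv i ^ 3 * yv j ∈ dihedralInv 3 Complex.I := by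
    convert quartic_mem_dihedralInv i i i j using 1; ring
  have h220 : xv i ^ 2 * xv j ^ 2 + yv i ^ 2 * yv j ^ 2 ∈ dihedralInv 3 Complex.I := by
    convert quartic_mem_dihedralInv i i j j using 1; ring
  have h211 : xv i ^ 2 * xv j * xv k + yv i ^ 2 * yv j * yv k ∈ dihedralInv 3 Complex.I := by
    convert quartic_mem_dihedralInv i i j k using 1; ring
  have h121 : xv i * xv j ^ 2 * xv k + yv i * yv j ^ 2 * yv k ∈ dihedralInv 3 Complex.I := by
    convert quartic_mem_dihedralInv i j j k using 1; ring
  fin_cases n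
  exacts [one_mem _, hu i j, h211, mul_mem (hu i j) (hu i k), h220, pow_mem (hu i j) 2, h310,
    mul_mem h310 (hu j k), mul_mem (pow_mem (hu i j) 2) (hu i k), pow_mem (hu i j) 3,
    mul_mem h310 (hu i k), mul_mem h211 h121, mul_mem h310 (pow_mem (hu j k) 2),
    mul_mem (mul_mem h310 (hu i k)) (hu j k), mul_mem (pow_mem (hu i j) 2) (pow_mem (hu i k) 2),
    mul_mem (pow_mem (hu i j) 3) (hu i k), pow_mem (hu i j) 4,
    mul_mem (mul_mem h310 (hu i k)) (pow_mem (hu j k) 2)]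

/-! ### The products of basis vectors span -/

lemma exists_xv_mul_basisVec (j : Fin 3) (a : Fin 8) : ∃ c ∈ P43, ∃ d ∈ P43, ∃ k l,
    xv j * basisVec j a = c * basisVec j k + d * basisVec j l := by
  have hp := pow_add_pow_mem_P43 j
  have hq := xv_mul_yv_mem_P43 j
  have hhalf : (C (1 / 2) : PolyVm 3) * 2 = 1 := by
    rw [← map_ofNat C 2, ← C_mul]; norm_num
  have h0 := P43.zero_mem
  have h1 := P43.one_mem
  have h2 := C_mem_P43 (1 / 2)
  fin_cases a
  · exact ⟨1, h1, 0, h0, 2, 0, by simp [basisVec]⟩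
  · exact ⟨_, hp, _, P43.neg_mem (P43.add_mem hq hq), 2, 7, by simp [basisVec]; ring⟩
  · exact ⟨1, h1, 0, h0, 4, 0, by simp [basisVec]; ring⟩
  · exact ⟨_, hq, 0, h0, 0, 0, by simp [basisVec]⟩
  · exact ⟨1, h1, 0, h0, 6, 0, by simp [basisVec]; ring⟩
  · exact ⟨_, hq, 0, h0, 3, 0, by simp [basisVec]; ring⟩
  · refine ⟨_, P43.mul_mem h2 hp, _, h2, 0, 1, ?_⟩
    simp only [basisVec, Fin.reduceFinMk, Matrix.cons_val]
    linear_combination -(xv j ^ 4) * hhalf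
  · exact ⟨_, hq, 0, h0, 5, 0, by simp [basisVec]; ring⟩

lemma exists_yv_mul_basisVec (j : Fin 3) (a : Fin 8) : ∃ c ∈ P43, ∃ d ∈ P43, ∃ k l,
    yv j * basisVec j a = c * basisVec j k + d * basisVec j l := by
  have hp := pow_add_pow_mem_P43 j
  have hq := xv_mul_yv_mem_P43 j
  have hhalf : (C (1 / 2) : PolyVm 3) * 2 = 1 := by
    rw [← map_ofNat C 2, ← C_mul]; norm_num
  have h0 := P43.zero_mem
  have h1 := P43.one_mem
  have h2 := C_mem_P43 (1 / 2)
  fin_cases a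
  · exact ⟨1, h1, 0, h0, 3, 0, by simp [basisVec]⟩
  · exact ⟨_, P43.neg_mem hp, _, P43.add_mem hq hq, 3, 6, by simp [basisVec]; ring⟩
  · exact ⟨_, hq, 0, h0, 0, 0, by simp [basisVec]; ring⟩
  · exact ⟨1, h1, 0, h0, 5, 0, by simp [basisVec]; ring⟩
  · exact ⟨_, hq, 0, h0, 2, 0, by simp [basisVec]; ring⟩
  · exact ⟨1, h1, 0, h0, 7, 0, by simp [basisVec]; ring⟩
  · exact ⟨_, hq, 0, h0, 4, 0, by simp [basisVec]; ring⟩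
  · refine ⟨_, P43.mul_mem h2 hp, _, P43.neg_mem h2, 0, 1, ?_⟩
    simp only [basisVec, Fin.reduceFinMk, Matrix.cons_val]
    linear_combination -(yv j ^ 4) * hhalf

lemma exists_X_mul_basisVec (p : Fin 2 × Fin 3) (a : Fin 8) : ∃ c ∈ P43, ∃ d ∈ P43, ∃ k l,
    X p * basisVec p.2 a = c * basisVec p.2 k + d * basisVec p.2 l := by
  obtain ⟨e, j⟩ := p
  fin_cases e
  exacts [exists_xv_mul_basisVec j a, exists_yv_mul_basisVec j a]

lemma prodVec_zero : prodVec (0, 0, 0) = 1 := by simp [prodVec, basisVec]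

lemma X_mul_prodVec_mem_span (p : Fin 2 × Fin 3) (b : Fin 8 × Fin 8 × Fin 8) :
    X p * prodVec b ∈ Submodule.span P43 (Set.range prodVec) := by
  have hmem (b) : prodVec b ∈ Submodule.span P43 (Set.range prodVec) :=
    Submodule.subset_span ⟨b, rfl⟩
  have hcomb {c d : PolyVm 3} (hc : c ∈ P43) (hd : d ∈ P43) (b b') :
      c * prodVec b + d * prodVec b' ∈ Submodule.span P43 (Set.range prodVec) :=
    Submodule.add_mem _ (P43_smul_mem _ hc (hmem b)) (P43_smul_mem _ hd (hmem b'))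
  obtain ⟨e, j⟩ := p
  obtain ⟨a₀, a₁, a₂⟩ := b
  fin_cases j
  · obtain ⟨c, hc, d, hd, k, l, h⟩ := exists_X_mul_basisVec (e, 0) a₀
    refine mem_of_eq _ ?_ (hcomb hc hd (k, a₁, a₂) (l, a₁, a₂))
    simp only [prodVec, Fin.zero_eta]
    linear_combination basisVec 1 a₁ * basisVec 2 a₂ * h
  · obtain ⟨c, hc, d, hd, k, l, h⟩ := exists_X_mul_basisVec (e, 1) a₁
    refine mem_of_eq _ ?_ (hcomb hc hd (a₀, k, a₂) (a₀, l, a₂))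
    simp only [prodVec, Fin.mk_one]
    linear_combination basisVec 0 a₀ * basisVec 2 a₂ * h
  · obtain ⟨c, hc, d, hd, k, l, h⟩ := exists_X_mul_basisVec (e, 2) a₂
    refine mem_of_eq _ ?_ (hcomb hc hd (a₀, a₁, k) (a₀, a₁, l))
    simp only [prodVec, Fin.reduceFinMk]
    linear_combination basisVec 0 a₀ * basisVec 1 a₁ * h

lemma mem_span_prodVec (f : PolyVm 3) : f ∈ Submodule.span P43 (Set.range prodVec) := by
  induction f using MvPolynomial.induction_on with
  | C c =>
    rw [← mul_one (C c), ← prodVec_zero]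
    exact P43_smul_mem _ (C_mem_P43 c) (Submodule.subset_span ⟨_, rfl⟩)
  | add f g hf hg => exact Submodule.add_mem _ hf hg
  | mul_X f p hf =>
    rw [mul_comm]
    induction hf using Submodule.span_induction with
    | mem g hg =>
      obtain ⟨b, rfl⟩ := hg
      exact X_mul_prodVec_mem_span p b
    | zero => simp
    | add g h _ _ hg hh =>
      rw [mul_add]
      exact Submodule.add_mem _ hg hh
    | smul c g _ hg =>
      rw [mul_smul_comm]
      exact Submodule.smul_mem _ c hg

/-! ### Averaging over the dihedral group -/

lemma actG_sMat_prodVec (b : Fin 8 × Fin 8 × Fin 8) :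
    actG sMat (prodVec b) = symProd b 0 1 2 - prodVec b := by
  have h (j a) : actG sMat (basisVec j a) = basisVecSwap j a := by
    fin_cases a <;> simp [basisVec, basisVecSwap, actG_sMat_xv, actG_sMat_yv]
  simp [prodVec, symProd, h]

lemma actG_dMat_basisVec (j : Fin 3) (a : Fin 8) :
    actG (dMat Complex.I) (basisVec j a) = C Complex.I ^ weight a * basisVec j a := by
  have hI := C_I_sq
  fin_cases a <;>
    simp only [basisVec, weight, Fin.zero_eta, Fin.mk_one, Fin.reduceFinMk, Matrix.cons_val,
      map_one, map_sub, map_pow (actG _), actG_dMat_xv, actG_dMat_yv] <;>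
    set ι : PolyVm 3 := C Complex.I
  · ring
  · linear_combination (xv j ^ 4 - yv j ^ 4) * (ι ^ 2 - 1) * hI
  · ring
  · linear_combination -(ι * yv j) * hI
  · ring
  · ring
  · ring
  · linear_combination -(ι * yv j ^ 3) * hI

lemma actG_dMat_prodVec (b : Fin 8 × Fin 8 × Fin 8) :
    actG (dMat Complex.I) (prodVec b) = C Complex.I ^ tripleWeight b * prodVec b := by
  simp only [prodVec, map_mul, actG_dMat_basisVec, tripleWeight, pow_add]
  ring

/-- The sum of all translates under the dihedral group. -/
def dihedralSum : PolyVm 3 →ₗ[P43] PolyVm 3 :=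
  let r := linearOfFix (actG (dMat Complex.I)) fun _ hc =>
    (mem_dihedralInv_iff.1 (P43_le_dihedralInv hc)).1
  let s := linearOfFix (actG sMat) fun _ hc => (mem_dihedralInv_iff.1 (P43_le_dihedralInv hc)).2
  (LinearMap.id + s) ∘ₗ (LinearMap.id + r + r ∘ₗ r + r ∘ₗ r ∘ₗ r)

lemma dihedralSum_apply (f : PolyVm 3) :
    dihedralSum f = f + actG (dMat Complex.I) f +
        actG (dMat Complex.I) (actG (dMat Complex.I) f) +
        actG (dMat Complex.I) (actG (dMat Complex.I) (actG (dMat Complex.I) f)) +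
      actG sMat (f + actG (dMat Complex.I) f +
        actG (dMat Complex.I) (actG (dMat Complex.I) f) +
        actG (dMat Complex.I) (actG (dMat Complex.I) (actG (dMat Complex.I) f))) := rfl

lemma dihedralSum_prodVec_of_weight {b : Fin 8 × Fin 8 × Fin 8} (hb : tripleWeight b % 4 = 0) :
    dihedralSum (prodVec b) = 4 * symProd b 0 1 2 := by
  have h : (C Complex.I : PolyVm 3) ^ tripleWeight b = 1 := by
    obtain ⟨k, hk⟩ := Nat.dvd_of_mod_eq_zero hb
    rw [hk, ← C_pow, pow_mul, Complex.I_pow_four, one_pow, C_1]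
  simp only [dihedralSum_apply, actG_dMat_prodVec, h, one_mul, map_add, actG_sMat_prodVec]
  ring

lemma dihedralSum_prodVec_of_weight_ne {b : Fin 8 × Fin 8 × Fin 8} (hb : tripleWeight b % 4 ≠ 0) :
    dihedralSum (prodVec b) = 0 := by
  have hz (f : PolyVm 3) : actG (dMat Complex.I) (C Complex.I ^ tripleWeight b * f) =
      C Complex.I ^ tripleWeight b * actG (dMat Complex.I) f := by
    rw [← C_pow, ← smul_eq_C_mul, map_smul, smul_eq_C_mul]
  have h : (1 + C Complex.I ^ tripleWeight b + (C Complex.I ^ tripleWeight b) ^ 2 +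
      (C Complex.I ^ tripleWeight b) ^ 3 : PolyVm 3) = 0 := by
    have h4 : (C Complex.I : PolyVm 3) ^ 4 = 1 := by rw [← C_pow, Complex.I_pow_four, C_1]
    have hI := C_I_sq
    rw [← Nat.div_add_mod (tripleWeight b) 4, pow_add, pow_mul, h4, one_pow, one_mul]
    have := Nat.mod_lt (tripleWeight b) (by norm_num : 0 < 4)
    set ι : PolyVm 3 := C Complex.I
    interval_cases tripleWeight b % 4
    · exact absurd rfl hb
    · linear_combination (1 + ι) * hI
    · linear_combination (1 + ι ^ 4) * hI
    · linear_combination (1 + ι ^ 3) * (1 - ι ^ 2 + ι ^ 4) * hI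
  have h' : prodVec b + actG (dMat Complex.I) (prodVec b) +
      actG (dMat Complex.I) (actG (dMat Complex.I) (prodVec b)) +
      actG (dMat Complex.I) (actG (dMat Complex.I) (actG (dMat Complex.I) (prodVec b))) = 0 := by
    simp only [actG_dMat_prodVec, hz]
    linear_combination prodVec b * h
  rw [dihedralSum_apply, h', map_zero, add_zero]

lemma mem_of_mem_dihedralInv {S : Submodule P43 (PolyVm 3)} (hS : ∀ n, HasForm S n)
    {f : PolyVm 3} (hf : f ∈ dihedralInv 3 Complex.I) : f ∈ S := by
  have hle : Submodule.span P43 (Set.range prodVec) ≤ S.comap dihedralSum := by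
    rw [Submodule.span_le]
    rintro _ ⟨b, rfl⟩
    by_cases hb : tripleWeight b % 4 = 0
    · change dihedralSum (prodVec b) ∈ S
      rw [dihedralSum_prodVec_of_weight hb]
      exact P43_smul_mem S (ofNat_mem P43 4) (symProd_mem hS hb)
    · change dihedralSum (prodVec b) ∈ S
      rw [dihedralSum_prodVec_of_weight_ne hb]
      exact S.zero_mem
  have h8 : dihedralSum f = 8 * f := by
    rw [mem_dihedralInv_iff] at hf
    simp only [dihedralSum_apply, hf.1, map_add, hf.2]
    ring
  have h : C (1 / 8) * dihedralSum f = f := by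
    rw [h8, ← mul_assoc, ← map_ofNat C 8, ← C_mul]
    norm_num
  rw [← h]
  exact P43_smul_mem S (C_mem_P43 _) (hle (mem_span_prodVec f))

/-- **Hironaka decomposition of `ℂ[V³]^{D₈}`**: for any choice of left coset
representatives of the stabilizers of the multidegrees, the `S₃`-translates of the
listed invariants form a basis of `ℂ[V³]^{D₈}` as a free `P(4,3)`-module. -/
theorem dihedral_invariants_V3_secondary_S_generators :
    ∀ C : Fin dihListD8.length → Set (Equiv.Perm (Fin 3)),
      (∀ i, IsCosetReps3 (dihListD8.get i).2 (C i)) →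
      LinearIndependent P43
        (fun x : (i : Fin dihListD8.length) × ↥(C i) =>
          permAct3 (x.2 : Equiv.Perm (Fin 3)) (dihListD8.get x.1).1) ∧
      ∀ f : PolyVm 3, f ∈ dihedralInv 3 Complex.I ↔
        f ∈ Submodule.span P43
              (Set.range (fun x : (i : Fin dihListD8.length) × ↥(C i) =>
                permAct3 (x.2 : Equiv.Perm (Fin 3)) (dihListD8.get x.1).1)) := by
  intro D hD
  have hD' : ∀ n : Fin 18, IsCosetReps3 (multidegree n) (D n) := fun n =>
    dihListD8_get_snd n ▸ hD n
  set g := fun x : (n : Fin dihListD8.length) × ↥(D n) =>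
    permAct3 (x.2 : Equiv.Perm (Fin 3)) (dihListD8.get x.1).1 with hg
  have hg_eq (n : Fin 18) (s : D n) :
      g ⟨n, s⟩ = C (1 / 2 : ℂ) ^ qDegree n * invForm n (s.1 0) (s.1 1) (s.1 2) := by
    simp only [hg]
    rw [dihListD8_get_eq, map_mul, map_pow, permAct3_invForm, ← algebraMap_eq, AlgHom.commutes]
  have hform : ∀ n, HasForm (Submodule.span P43 (Set.range g)) n := by
    refine hasForm_all hD' fun n s hs => ?_
    have h : C (2 : ℂ) ^ qDegree n * g ⟨n, ⟨s, hs⟩⟩ = invForm n (s 0) (s 1) (s 2) := by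
      rw [hg_eq, ← mul_assoc, ← mul_pow, ← C_mul]
      norm_num
    rw [← h]
    exact P43_smul_mem _ (P43.pow_mem (C_mem_P43 2) _) (Submodule.subset_span ⟨_, rfl⟩)
  have hinv : ∀ x, g x ∈ dihedralInv 3 Complex.I := by
    rintro ⟨n, s⟩
    rw [show g ⟨n, s⟩ = _ from hg_eq n s]
    exact mul_mem (pow_mem ((dihedralInv 3 Complex.I).algebraMap_mem _) _)
      (invForm_mem_dihedralInv _ _ _ _)
  refine ⟨?_, fun f => ⟨mem_of_mem_dihedralInv hform, fun hf => ?_⟩⟩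
  · have (n : Fin 18) : Fintype (D n) := Fintype.ofFinite _
    let : Fintype ((n : Fin dihListD8.length) × D n) :=
      inferInstanceAs (Fintype ((n : Fin 18) × D n))
    have hcard : Fintype.card ((n : Fin 18) × D n) ≤ Fintype.card symReps := by
      rw [Fintype.card_coe, card_symReps]
      exact card_sigma_le hD'
    refine linearIndependent_of_card_le linearIndependent_symProd (fun b => ?_) hcard
    exact symProd_mem hform (Finset.mem_filter.1 b.2).2.1
  · induction hf using Submodule.span_induction with
    | mem f hf =>
      obtain ⟨x, rfl⟩ := hf
      exact hinv x
    | zero => exact zero_mem _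
    | add f h _ _ hf hh => exact add_mem hf hh
    | smul c f _ hf => exact mul_mem (P43_le_dihedralInv c.2) hf

end
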